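/- arXiv:2406.07265 — 3 statements merged into one kernel-verified Lean document; each statement's English description precedes it below -/
import Mathlib

section
/- Let q ∈ ℂ^× with 0 < |q| < 1, let ξ, ρ_1, ρ_2, κ_1, κ_2 ∈ ℂ^× with ρ_2/ρ_1 ∉ q^ℤ and κ_2/κ_1 ∉ q^ℤ, set η = κ_1κ_2/(ρ_1ρ_2), and let m_{11}, m_{12}, m_{21}, m_{22}, K ∈ ℂ. Then the identity m_{11}m_{22} θ_q((κ_1/ρ_1)(x/ξ)) θ_q((κ_2/ρ_2)(x/ξ)) − m_{12}m_{21} θ_q((κ_1/ρ_2)(x/ξ)) θ_q((κ_2/ρ_1)(x/ξ)) = K θ_q(ηx/ξ) θ_q(x/ξ) holds for all x ∈ ℂ^× if and only if both m_{11}m_{22} = K θ_q(ρ_2/κ_1)θ_q(κ_2/ρ_1) / (θ_q(ρ_2/ρ_1)θ_q(κ_2/κ_1)) and m_{12}m_{21} = −K (κ_2/ρ_1) θ_q(ρ_1/κ_1)θ_q(ρ_2/κ_2) / (θ_q(ρ_2/ρ_1)θ_q(κ_2/κ_1)). -/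
noncomputable section

/-- The theta function `θ_q(x) = ∏_{k≥0} (1 − q^k x)(1 − q^{k+1}/x)(1 − q^{k+1})`. -/
def theta (q x : ℂ) : ℂ :=
  ∏' k : ℕ, ((1 - q ^ k * x) * (1 - q ^ (k + 1) / x) * (1 - q ^ (k + 1)))

open Finset Filter Topology

/-! ### Gaussian binomial coefficients and the finite triple product -/

/-- The Gaussian binomial coefficient. -/
def gaussBinom (q : ℂ) : ℕ → ℕ → ℂ
  | _, 0 => 1
  | 0, _ + 1 => 0
  | n + 1, k + 1 => q ^ (k + 1) * gaussBinom q n (k + 1) + gaussBinom q n k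

@[simp]
lemma gaussBinom_zero_right (q : ℂ) (n : ℕ) : gaussBinom q n 0 = 1 := by
  cases n <;> rfl

lemma gaussBinom_succ_succ (q : ℂ) (n k : ℕ) :
    gaussBinom q (n + 1) (k + 1) = q ^ (k + 1) * gaussBinom q n (k + 1) + gaussBinom q n k := rfl

lemma gaussBinom_eq_zero_of_lt (q : ℂ) {n k : ℕ} (h : n < k) : gaussBinom q n k = 0 := by
  induction n generalizing k with
  | zero =>
    obtain ⟨k, rfl⟩ := Nat.exists_eq_succ_of_ne_zero h.ne'
    rfl
  | succ n ih =>
    obtain ⟨k, rfl⟩ := Nat.exists_eq_succ_of_ne_zero (Nat.ne_zero_of_lt h)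
    rw [Nat.succ_eq_add_one, gaussBinom_succ_succ, ih (by omega), ih (by omega)]
    simp

/-- The finite `q`-Pochhammer symbol `(q; q)_n`. -/
def eulerProd (q : ℂ) (n : ℕ) : ℂ := ∏ k ∈ range n, (1 - q ^ (k + 1))

lemma eulerProd_succ (q : ℂ) (n : ℕ) :
    eulerProd q (n + 1) = eulerProd q n * (1 - q ^ (n + 1)) := prod_range_succ _ _

lemma gaussBinom_add_mul (q : ℂ) (j m : ℕ) :
    gaussBinom q (j + m) j * (eulerProd q j * eulerProd q m) = eulerProd q (j + m) := by
  induction h : j + m generalizing j m with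
  | zero =>
    obtain ⟨rfl, rfl⟩ : j = 0 ∧ m = 0 := by omega
    simp [eulerProd]
  | succ n ih =>
    rcases j with _ | j
    · obtain rfl : m = n + 1 := by omega
      simp [eulerProd]
    rw [gaussBinom_succ_succ]
    have h2 := ih j m (by omega)
    rcases m with _ | m
    · obtain rfl : j = n := by omega
      rw [gaussBinom_eq_zero_of_lt q (Nat.lt_succ_self j)]
      simp only [eulerProd_succ] at *
      linear_combination (1 - q ^ (j + 1)) * h2
    · have h1 := ih (j + 1) m (by omega)
      obtain rfl : n = j + m + 1 := by omega
      simp only [eulerProd_succ] at *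
      linear_combination q ^ (j + 1) * (1 - q ^ (m + 1)) * h1 + (1 - q ^ (j + 1)) * h2

/-- The general term of the Laurent expansion of `theta (p ^ 4)`. -/
def thetaTerm (p x : ℂ) (n : ℤ) : ℂ := (-1) ^ n * p ^ (2 * n ^ 2 - 2 * n) * x ^ n

lemma thetaTerm_zero (p x : ℂ) : thetaTerm p x 0 = 1 := by simp [thetaTerm]

lemma thetaTerm_mul_left (p x : ℂ) (n : ℤ) :
    thetaTerm p (p ^ 4 * x) n = p ^ (4 * n) * thetaTerm p x n := by
  rw [thetaTerm, thetaTerm, mul_zpow, zpow_mul]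
  norm_cast
  ring

lemma thetaTerm_add_one {p x : ℂ} (hp : p ≠ 0) (hx : x ≠ 0) (n : ℤ) :
    thetaTerm p x (n + 1) = -x * p ^ (4 * n) * thetaTerm p x n := by
  rw [thetaTerm, thetaTerm, zpow_add_one₀ hx, zpow_add_one₀ (by norm_num),
    show 2 * (n + 1) ^ 2 - 2 * (n + 1) = 4 * n + (2 * n ^ 2 - 2 * n) by ring, zpow_add₀ hp]
  ring

lemma thetaTerm_sub {p x : ℂ} (hp : p ≠ 0) (hx : x ≠ 0) (j n : ℤ) :
    thetaTerm p (p ^ (-4 * n) * x) j * thetaTerm p x (-n) = thetaTerm p x (j - n) := by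
  rw [thetaTerm, thetaTerm, thetaTerm, mul_zpow, ← zpow_mul, sub_eq_add_neg j n, zpow_add₀ hx,
    zpow_add₀ (by norm_num),
    show 2 * (j + -n) ^ 2 - 2 * (j + -n)
      = (2 * j ^ 2 - 2 * j) + (-4 * n * j) + (2 * (-n) ^ 2 - 2 * (-n)) by ring,
    zpow_add₀ hp, zpow_add₀ hp]
  ring

lemma prod_one_sub_eq_sum {p : ℂ} (hp : p ≠ 0) (N : ℕ) {x : ℂ} (hx : x ≠ 0) :
    ∏ k ∈ range N, (1 - (p ^ 4) ^ k * x)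
      = ∑ j ∈ range (N + 1), thetaTerm p x j * gaussBinom (p ^ 4) N j := by
  induction N generalizing x with
  | zero => simp [thetaTerm_zero]
  | succ N ih =>
    have hqx : p ^ 4 * x ≠ 0 := by positivity
    have hstep : ∏ k ∈ range N, (1 - (p ^ 4) ^ (k + 1) * x)
        = ∏ k ∈ range N, (1 - (p ^ 4) ^ k * (p ^ 4 * x)) := by
      refine prod_congr rfl fun k _ ↦ ?_
      ring
    have hpow (j : ℕ) : p ^ (4 * (j : ℤ)) = (p ^ 4) ^ j := by
      rw [zpow_mul]; norm_cast
    rw [prod_range_succ', hstep, ih hqx,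
      sum_range_succ' (fun j ↦ thetaTerm p x j * gaussBinom (p ^ 4) (N + 1) j)]
    have hext : ∑ j ∈ range (N + 1), thetaTerm p (p ^ 4 * x) j * gaussBinom (p ^ 4) N j
        = ∑ j ∈ range (N + 1),
            thetaTerm p x (j + 1) * ((p ^ 4) ^ (j + 1) * gaussBinom (p ^ 4) N (j + 1)) + 1 := by
      rw [← add_zero (∑ j ∈ range (N + 1), thetaTerm p (p ^ 4 * x) j * gaussBinom (p ^ 4) N j),
        ← mul_zero (thetaTerm p (p ^ 4 * x) (N + 1 : ℕ)),
        ← gaussBinom_eq_zero_of_lt (p ^ 4) (Nat.lt_succ_self N), ← sum_range_succ, sum_range_succ']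
      congr 1
      · refine sum_congr rfl fun j _ ↦ ?_
        rw [thetaTerm_mul_left, hpow]
        push_cast
        ring
      · simp [thetaTerm_zero]
    rw [pow_zero, one_mul, mul_sub, mul_one]
    nth_rewrite 1 [hext]
    simp only [gaussBinom_succ_succ, mul_add, sum_add_distrib, Nat.cast_zero, thetaTerm_zero,
      gaussBinom_zero_right, sum_mul]
    have : ∑ j ∈ range (N + 1), thetaTerm p (p ^ 4 * x) j * gaussBinom (p ^ 4) N j * x
        = -∑ j ∈ range (N + 1), thetaTerm p x ((j + 1 : ℕ) : ℤ) * gaussBinom (p ^ 4) N j := by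
      rw [← sum_neg_distrib]
      refine sum_congr rfl fun j _ ↦ ?_
      push_cast
      rw [thetaTerm_mul_left, thetaTerm_add_one hp hx]
      ring
    rw [this]
    push_cast
    ring

lemma finite_triple_product {p : ℂ} (hp : p ≠ 0) (n : ℕ) {x : ℂ} (hx : x ≠ 0) :
    ∏ k ∈ range n, ((1 - (p ^ 4) ^ k * x) * (1 - (p ^ 4) ^ (k + 1) / x))
      = ∑ j ∈ range (2 * n + 1), thetaTerm p x (j - n) * gaussBinom (p ^ 4) (2 * n) j := by
  have hneg : thetaTerm p x (-n) * ∏ k ∈ range n, (1 - p ^ (-4 * (k + 1 : ℤ)) * x)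
      = ∏ k ∈ range n, (1 - (p ^ 4) ^ (k + 1) / x) := by
    induction n with
    | zero => simp [thetaTerm_zero]
    | succ n ih =>
      have hexp : p ^ (4 * (n + 1 : ℤ)) = (p ^ 4) ^ (n + 1) := by
        rw [zpow_mul]; norm_cast
      have h1 := thetaTerm_add_one hp hx (-(n + 1 : ℤ))
      rw [show -(n + 1 : ℤ) + 1 = -n by ring, mul_neg, zpow_neg, hexp] at h1
      rw [prod_range_succ, prod_range_succ, ← ih, h1, neg_mul, zpow_neg, hexp]
      generalize ∏ k ∈ range n, (1 - p ^ (-4 * (k + 1 : ℤ)) * x) = P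
      push_cast
      field_simp
      ring
  have hreflect : ∏ k ∈ range n, (1 - (p ^ 4) ^ k * (p ^ (-4 * (n : ℤ)) * x))
      = ∏ k ∈ range n, (1 - p ^ (-4 * (k + 1 : ℤ)) * x) := by
    rw [← prod_range_reflect]
    refine prod_congr rfl fun k hk ↦ ?_
    have hk' : k + 1 ≤ n := mem_range.1 hk
    rw [← mul_assoc, ← pow_mul, ← zpow_natCast, ← zpow_add₀ hp]
    congr 3
    rw [Nat.sub_sub, add_comm 1 k]
    push_cast [hk']
    ring
  have hshift : ∏ k ∈ range n, (1 - (p ^ 4) ^ (n + k) * (p ^ (-4 * (n : ℤ)) * x))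
      = ∏ k ∈ range n, (1 - (p ^ 4) ^ k * x) := by
    refine prod_congr rfl fun k _ ↦ ?_
    rw [← mul_assoc, ← pow_mul, ← zpow_natCast, ← zpow_add₀ hp, ← pow_mul, ← zpow_natCast]
    congr 3
    push_cast
    ring
  have hy : p ^ (-4 * (n : ℤ)) * x ≠ 0 := mul_ne_zero (zpow_ne_zero _ hp) hx
  have key := prod_one_sub_eq_sum hp (2 * n) hy
  rw [two_mul, prod_range_add, hreflect, hshift, ← two_mul] at key
  rw [prod_mul_distrib, ← hneg, mul_left_comm, mul_comm (∏ k ∈ range n, (1 - (p ^ 4) ^ k * x)), key,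
    mul_sum]
  refine sum_congr rfl fun j _ ↦ ?_
  rw [← thetaTerm_sub hp hx]
  ring

/-! ### The Jacobi triple product -/

lemma summable_norm_geom (q c : ℂ) (hq : ‖q‖ < 1) : Summable fun k : ℕ ↦ ‖-(q ^ k * c)‖ := by
  simp only [norm_neg, norm_mul, norm_pow]
  exact (summable_geometric_of_lt_one (norm_nonneg _) hq).mul_right _

lemma one_sub_pow_succ_ne_zero {q : ℂ} (hq : ‖q‖ < 1) (k : ℕ) : 1 - q ^ (k + 1) ≠ 0 := by
  intro h
  have h1 : ‖q ^ (k + 1)‖ = 1 := by rw [← sub_eq_zero.1 h, norm_one]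
  rw [norm_pow] at h1
  exact (pow_lt_one₀ (norm_nonneg _) hq k.succ_ne_zero).ne h1

lemma multipliable_one_sub_geom {q : ℂ} (hq : ‖q‖ < 1) (c : ℂ) :
    Multipliable fun k : ℕ ↦ 1 - q ^ k * c := by
  simpa only [sub_eq_add_neg] using multipliable_one_add_of_summable (summable_norm_geom q c hq)

lemma tprod_one_sub_geom_ne_zero {q : ℂ} (hq : ‖q‖ < 1) (c : ℂ) (h : ∀ k : ℕ, 1 - q ^ k * c ≠ 0) :
    ∏' k : ℕ, (1 - q ^ k * c) ≠ 0 := by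
  simp only [sub_eq_add_neg] at h ⊢
  exact tprod_one_add_ne_zero_of_summable h (summable_norm_geom q c hq)

lemma theta_hasProd {q : ℂ} (hq : ‖q‖ < 1) (x : ℂ) :
    HasProd (fun k : ℕ ↦ (1 - q ^ k * x) * (1 - q ^ (k + 1) / x) * (1 - q ^ (k + 1)))
      ((∏' k : ℕ, (1 - q ^ k * x)) * (∏' k : ℕ, (1 - q ^ k * (q / x)))
        * ∏' k : ℕ, (1 - q ^ k * q)) := by
  convert ((multipliable_one_sub_geom hq x).hasProd.mul
    (multipliable_one_sub_geom hq (q / x)).hasProd).mul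
    (multipliable_one_sub_geom hq q).hasProd using 2 with k
  rw [pow_succ, mul_div_assoc]

lemma theta_ne_zero {q : ℂ} (hq : ‖q‖ < 1) {x : ℂ} (hx : x ≠ 0)
    (h : ∀ m : ℤ, x ≠ q ^ m) : theta q x ≠ 0 := by
  rw [theta, (theta_hasProd hq x).tprod_eq]
  refine mul_ne_zero (mul_ne_zero ?_ ?_) ?_ <;> refine tprod_one_sub_geom_ne_zero hq _ fun k hk ↦ ?_
  · refine h (-k) ?_
    rw [zpow_neg, zpow_natCast]
    exact eq_inv_of_mul_eq_one_right (sub_eq_zero.1 hk).symm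
  · refine h (k + 1 : ℕ) ?_
    rw [zpow_natCast, pow_succ]
    rw [← mul_div_assoc, sub_eq_zero, eq_comm, div_eq_one_iff_eq hx] at hk
    exact hk.symm
  · exact one_sub_pow_succ_ne_zero hq k (by rwa [pow_succ])

lemma theta_one (q : ℂ) : theta q 1 = 0 :=
  tprod_of_exists_eq_zero ⟨0, by simp⟩

lemma eulerProd_ne_zero {q : ℂ} (hq : ‖q‖ < 1) (n : ℕ) : eulerProd q n ≠ 0 :=
  prod_ne_zero_iff.2 fun k _ ↦ one_sub_pow_succ_ne_zero hq k

lemma exists_tendsto_eulerProd {q : ℂ} (hq : ‖q‖ < 1) :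
    ∃ L : ℂ, L ≠ 0 ∧ Tendsto (eulerProd q) atTop (𝓝 L) := by
  refine ⟨_, tprod_one_sub_geom_ne_zero hq q fun k ↦ ?_, ?_⟩
  · simpa only [pow_succ] using one_sub_pow_succ_ne_zero hq k
  · convert (multipliable_one_sub_geom hq q).tendsto_prod_tprod_nat using 1
    ext n
    simp only [eulerProd, pow_succ]

lemma gaussBinom_eq_div {q : ℂ} (hq : ‖q‖ < 1) (j m : ℕ) :
    gaussBinom q (j + m) j = eulerProd q (j + m) / (eulerProd q j * eulerProd q m) :=
  eq_div_of_mul_eq (mul_ne_zero (eulerProd_ne_zero hq j) (eulerProd_ne_zero hq m))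
    (gaussBinom_add_mul q j m)

lemma exists_norm_gaussBinom_mul_le {q : ℂ} (hq : ‖q‖ < 1) :
    ∃ B : ℝ, ∀ N j n : ℕ, ‖gaussBinom q N j * eulerProd q n‖ ≤ B := by
  obtain ⟨L, hL, hlim⟩ := exists_tendsto_eulerProd hq
  obtain ⟨M, hM⟩ : ∃ M, ∀ n, ‖eulerProd q n‖ ≤ M :=
    hlim.norm.bddAbove_range.imp fun _ h n ↦ h ⟨n, rfl⟩
  obtain ⟨M', hM'⟩ : ∃ M', ∀ n, ‖(eulerProd q n)⁻¹‖ ≤ M' :=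
    (hlim.inv₀ hL).norm.bddAbove_range.imp fun _ h n ↦ h ⟨n, rfl⟩
  have hM0 : 0 ≤ M := (norm_nonneg _).trans (hM 0)
  have hM0' : 0 ≤ M' := (norm_nonneg _).trans (hM' 0)
  refine ⟨M * (M' * M') * M, fun N j n ↦ ?_⟩
  rcases lt_or_ge N j with h | h
  · rw [gaussBinom_eq_zero_of_lt q h, zero_mul, norm_zero]
    positivity
  · obtain ⟨m, rfl⟩ := Nat.exists_eq_add_of_le h
    rw [gaussBinom_eq_div hq, div_eq_mul_inv, mul_inv, norm_mul, norm_mul, norm_mul]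
    gcongr <;> apply_assumption

lemma tendsto_gaussBinom_mul {q : ℂ} (hq : ‖q‖ < 1) (m : ℤ) :
    Tendsto (fun n : ℕ ↦ gaussBinom q (2 * n) (m + n).toNat * eulerProd q n) atTop (𝓝 1) := by
  obtain ⟨L, hL, hlim⟩ := exists_tendsto_eulerProd hq
  have hshift (m : ℤ) : Tendsto (fun n : ℕ ↦ (m + n).toNat) atTop atTop :=
    tendsto_atTop.2 fun b ↦ (eventually_ge_atTop (b + m.natAbs)).mono fun n hn ↦ by omega
  have hdouble : Tendsto (fun n : ℕ ↦ 2 * n) atTop atTop :=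
    tendsto_atTop.2 fun b ↦ (eventually_ge_atTop b).mono fun n hn ↦ by omega
  have hmain := ((hlim.comp hdouble).div ((hlim.comp (hshift m)).mul (hlim.comp (hshift (-m))))
    (mul_ne_zero hL hL)).mul hlim
  rw [show L / (L * L) * L = 1 by field_simp] at hmain
  refine hmain.congr' ((eventually_ge_atTop m.natAbs).mono fun n hn ↦ ?_)
  obtain ⟨k, hk⟩ : ∃ k : ℕ, (-m + n).toNat = k := ⟨_, rfl⟩
  obtain ⟨j, hj⟩ : ∃ j : ℕ, (m + n).toNat = j := ⟨_, rfl⟩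
  have hjk : 2 * n = j + k := by omega
  simp only [Pi.div_apply, Function.comp_apply, hj, hk, hjk, gaussBinom_eq_div hq]

lemma summable_zpow_sq_mul_zpow {p x : ℂ} (hp0 : p ≠ 0) (hp : ‖p‖ < 1) (hx : x ≠ 0) :
    Summable fun n : ℤ ↦ p ^ (n ^ 2) * x ^ n := by
  have hπ : (Real.pi : ℂ) ≠ 0 := by exact_mod_cast Real.pi_ne_zero
  have him : 0 < (Complex.log p / (Real.pi * Complex.I)).im := by
    have : Complex.log p / (Real.pi * Complex.I) = (-Complex.I * Complex.log p) / (Real.pi : ℝ) := by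
      field_simp
      simp
    rw [this, Complex.div_ofReal_im]
    refine div_pos ?_ Real.pi_pos
    simpa [Complex.log_re] using Real.log_neg (norm_pos_iff.2 hp0) hp
  refine ((summable_jacobiTheta₂_term_iff (Complex.log x / (2 * Real.pi * Complex.I)) _).2
    him).congr fun n ↦ ?_
  rw [jacobiTheta₂_term, Complex.exp_add, mul_comm]
  congr 1
  · nth_rewrite 2 [← Complex.exp_log hp0]
    rw [← Complex.exp_int_mul]
    congr 1
    push_cast
    field_simp
  · nth_rewrite 2 [← Complex.exp_log hx]
    rw [← Complex.exp_int_mul]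
    congr 1
    field_simp

lemma summable_thetaTerm {p x : ℂ} (hp0 : p ≠ 0) (hp : ‖p‖ < 1) (hx : x ≠ 0) :
    Summable (thetaTerm p x) := by
  have hp2 : ‖p ^ 2‖ < 1 := by
    rw [norm_pow]; exact pow_lt_one₀ (norm_nonneg _) hp two_ne_zero
  refine (summable_zpow_sq_mul_zpow (p := p ^ 2) (x := -(p ^ (-2 : ℤ) * x)) (by positivity) hp2
    (neg_ne_zero.2 (mul_ne_zero (zpow_ne_zero _ hp0) hx))).congr fun n ↦ ?_
  rw [thetaTerm, ← neg_one_mul, mul_zpow, mul_zpow, ← zpow_mul, ← zpow_natCast, ← zpow_mul,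
    show 2 * n ^ 2 - 2 * n = (2 : ℕ) * n ^ 2 + -2 * n by push_cast; ring, zpow_add₀ hp0]
  ring

theorem theta_eq_tsum {p x : ℂ} (hp0 : p ≠ 0) (hp : ‖p‖ < 1) (hx : x ≠ 0) :
    theta (p ^ 4) x = ∑' n : ℤ, thetaTerm p x n := by
  have hq : ‖p ^ 4‖ < 1 := by
    rw [norm_pow]; exact pow_lt_one₀ (norm_nonneg _) hp four_ne_zero
  let f (n : ℕ) (m : ℤ) : ℂ := if -(n : ℤ) ≤ m then
    thetaTerm p x m * (gaussBinom (p ^ 4) (2 * n) (m + n).toNat * eulerProd (p ^ 4) n) else 0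
  have hfin (n : ℕ) : ∑' m, f n m = ∏ k ∈ range n,
      ((1 - (p ^ 4) ^ k * x) * (1 - (p ^ 4) ^ (k + 1) / x) * (1 - (p ^ 4) ^ (k + 1))) := by
    have hinj : Function.Injective fun j : ℕ ↦ (j : ℤ) - n := fun a b h ↦ by simpa using h
    have hval (j : ℕ) : f n (j - n)
        = thetaTerm p x (j - n) * gaussBinom (p ^ 4) (2 * n) j * eulerProd (p ^ 4) n := by
      simp [f, mul_assoc]
    refine HasSum.tsum_eq ((hinj.hasSum_iff fun m hm ↦ if_neg fun h ↦ hm ?_).1 ?_)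
    · exact ⟨(m + n).toNat, by simp only; omega⟩
    · rw [prod_mul_distrib, finite_triple_product hp0 n hx, ← eulerProd, sum_mul]
      rw [← sum_congr rfl fun j _ ↦ hval j]
      refine hasSum_sum_of_ne_finset_zero (f := f n ∘ fun j : ℕ ↦ (j : ℤ) - n) fun j hj ↦ ?_
      rw [Function.comp_apply, hval, gaussBinom_eq_zero_of_lt _ (by simpa using hj)]
      simp
  obtain ⟨B, hB⟩ := exists_norm_gaussBinom_mul_le hq
  have hB0 : 0 ≤ B := (norm_nonneg _).trans (hB 0 0 0)
  have hlim : Tendsto (fun n ↦ ∑' m, f n m) atTop (𝓝 (∑' m, thetaTerm p x m)) := by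
    refine tendsto_tsum_of_dominated_convergence ((summable_thetaTerm hp0 hp hx).norm.mul_right B)
      (fun m ↦ ?_) (.of_forall fun n m ↦ ?_)
    · have := (tendsto_gaussBinom_mul hq m).const_mul (thetaTerm p x m)
      rw [mul_one] at this
      refine this.congr' ((eventually_ge_atTop m.natAbs).mono fun n hn ↦ ?_)
      exact (if_pos (by omega)).symm
    · simp only [f]
      split_ifs
      · rw [norm_mul]
        gcongr
        exact hB _ _ _
      · rw [norm_zero]
        positivity
  refine tendsto_nhds_unique ?_ hlim
  simp only [hfin]
  exact (theta_hasProd hq x).multipliable.tendsto_prod_tprod_nat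

lemma exists_fourth_root {q : ℂ} (hq0 : q ≠ 0) (hq : ‖q‖ < 1) :
    ∃ p : ℂ, p ≠ 0 ∧ ‖p‖ < 1 ∧ p ^ 4 = q := by
  obtain ⟨p, rfl⟩ := IsAlgClosed.exists_pow_nat_eq q four_pos
  rw [norm_pow, pow_lt_one_iff_of_nonneg (norm_nonneg _) four_ne_zero] at hq
  exact ⟨p, (pow_ne_zero_iff four_ne_zero).1 hq0, hq, rfl⟩

lemma theta_inv {q x : ℂ} (hq0 : q ≠ 0) (hq : ‖q‖ < 1) (hx : x ≠ 0) :
    theta q x⁻¹ = -x⁻¹ * theta q x := by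
  obtain ⟨p, hp0, hp, rfl⟩ := exists_fourth_root hq0 hq
  rw [theta_eq_tsum hp0 hp (inv_ne_zero hx), theta_eq_tsum hp0 hp hx, ← tsum_mul_left,
    ← (Equiv.subLeft (1 : ℤ)).tsum_eq]
  refine tsum_congr fun n ↦ ?_
  rw [Equiv.subLeft_apply, thetaTerm, thetaTerm,
    show 2 * (1 - n) ^ 2 - 2 * (1 - n) = 2 * n ^ 2 - 2 * n by ring, inv_zpow', neg_sub,
    zpow_sub_one₀ hx, zpow_sub₀ (by norm_num), zpow_one, div_eq_mul_inv, ← inv_zpow,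
    inv_neg_one]
  ring

/-! ### The addition theorem -/

/-- The part `∑ p ^ n² v ^ n`, over the integers `n = 2 k + ε`, of a theta series. -/
def thetaPart (p : ℂ) (ε : ℤ) (v : ℂ) : ℂ := ∑' k : ℤ, p ^ (2 * k + ε) ^ 2 * v ^ (2 * k + ε)

lemma summable_thetaPart {p v : ℂ} (hp0 : p ≠ 0) (hp : ‖p‖ < 1) (hv : v ≠ 0) (ε : ℤ) :
    Summable fun k : ℤ ↦ p ^ (2 * k + ε) ^ 2 * v ^ (2 * k + ε) :=
  (summable_zpow_sq_mul_zpow hp0 hp hv).comp_injective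
    (i := fun k : ℤ ↦ 2 * k + ε) fun a b h ↦ by simpa using h

lemma thetaPart_zero_inv (p v : ℂ) : thetaPart p 0 v⁻¹ = thetaPart p 0 v := by
  rw [thetaPart, thetaPart, ← (Equiv.neg ℤ).tsum_eq]
  refine tsum_congr fun k ↦ ?_
  rw [Equiv.neg_apply, inv_zpow', show (2 * -k + 0) ^ 2 = (2 * k + 0) ^ 2 by ring,
    show -(2 * -k + 0) = 2 * k + 0 by ring]

lemma thetaPart_one_inv (p v : ℂ) : thetaPart p 1 v⁻¹ = thetaPart p 1 v := by
  rw [thetaPart, thetaPart, ← (Equiv.subLeft (-1 : ℤ)).tsum_eq]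
  refine tsum_congr fun k ↦ ?_
  rw [Equiv.subLeft_apply, inv_zpow', show (2 * (-1 - k) + 1) ^ 2 = (2 * k + 1) ^ 2 by ring,
    show -(2 * (-1 - k) + 1) = 2 * k + 1 by ring]

/-- The pairs of integers, split by the parity of their sum. -/
def intProdParityEquiv : (ℤ × ℤ) ⊕ (ℤ × ℤ) ≃ ℤ × ℤ where
  toFun := Sum.elim (fun z ↦ (z.1 + z.2, z.1 - z.2)) fun z ↦ (z.1 + z.2 + 1, z.1 - z.2)
  invFun z := if (z.1 + z.2) % 2 = 0 then .inl ((z.1 + z.2) / 2, (z.1 - z.2) / 2)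
    else .inr ((z.1 + z.2) / 2, (z.1 - z.2) / 2)
  left_inv := by
    rintro (⟨a, b⟩ | ⟨a, b⟩)
    · exact (if_pos (show (a + b + (a - b)) % 2 = 0 by omega)).trans (congrArg Sum.inl (Prod.ext
        (show (a + b + (a - b)) / 2 = a by omega) (show (a + b - (a - b)) / 2 = b by omega)))
    · exact (if_neg (show ¬(a + b + 1 + (a - b)) % 2 = 0 by omega)).trans (congrArg Sum.inr
        (Prod.ext (show (a + b + 1 + (a - b)) / 2 = a by omega)
          (show (a + b + 1 - (a - b)) / 2 = b by omega)))
  right_inv := by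
    rintro ⟨a, b⟩
    simp only
    split_ifs <;> simp only [Sum.elim_inl, Sum.elim_inr, Prod.mk.injEq] <;> omega

lemma intProdParityEquiv_inl (z : ℤ × ℤ) :
    intProdParityEquiv (.inl z) = (z.1 + z.2, z.1 - z.2) := rfl

lemma intProdParityEquiv_inr (z : ℤ × ℤ) :
    intProdParityEquiv (.inr z) = (z.1 + z.2 + 1, z.1 - z.2) := rfl

/-- The determinant of the even and odd theta series at two points. -/
def thetaWronskian (p u v : ℂ) : ℂ :=
  thetaPart p 1 u * thetaPart p 0 v - thetaPart p 0 u * thetaPart p 1 v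

lemma thetaWronskian_inv_left (p u v : ℂ) : thetaWronskian p u⁻¹ v = thetaWronskian p u v := by
  simp only [thetaWronskian, thetaPart_zero_inv, thetaPart_one_inv]

lemma thetaWronskian_inv_right (p u v : ℂ) : thetaWronskian p u v⁻¹ = thetaWronskian p u v := by
  simp only [thetaWronskian, thetaPart_zero_inv, thetaPart_one_inv]

lemma thetaWronskian_plucker (p a b c d : ℂ) :
    thetaWronskian p a b * thetaWronskian p c d - thetaWronskian p a c * thetaWronskian p b d
      + thetaWronskian p a d * thetaWronskian p b c = 0 := by
  simp only [thetaWronskian]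
  ring

lemma thetaTerm_mul_thetaTerm {p u v : ℂ} (hp : p ≠ 0) (hu : u ≠ 0) (hv : v ≠ 0) (m n : ℤ) :
    thetaTerm p (u * v) m * thetaTerm p (u / v) n
      = (-1) ^ (m + n) * p ^ (2 * m ^ 2 - 2 * m + (2 * n ^ 2 - 2 * n)) * u ^ (m + n)
        * v ^ (m - n) := by
  rw [thetaTerm, thetaTerm, mul_zpow, div_zpow, zpow_add₀ (by norm_num), zpow_add₀ hp,
    zpow_add₀ hu, zpow_sub₀ hv]
  ring

lemma hasSum_mul_of_summable {f g : ℤ → ℂ} (hf : Summable f) (hg : Summable g) :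
    HasSum (fun z : ℤ × ℤ ↦ f z.1 * g z.2) ((∑' i, f i) * ∑' k, g k) := by
  rw [tsum_mul_tsum_of_summable_norm hf.norm hg.norm]
  exact (summable_mul_of_summable_norm hf.norm hg.norm).hasSum

lemma theta_mul_theta {p u v : ℂ} (hp0 : p ≠ 0) (hp : ‖p‖ < 1) (hu : u ≠ 0) (hv : v ≠ 0) :
    theta (p ^ 4) (u * v) * theta (p ^ 4) (u / v) = p⁻¹ * u * thetaWronskian p u v := by
  have huv := mul_ne_zero hu hv
  have huv' := div_ne_zero hu hv
  have hodd : ∑' i : ℤ, p ^ (2 * i - 1) ^ 2 * u ^ (2 * i - 1) = thetaPart p 1 u := by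
    rw [thetaPart, ← (Equiv.addRight (1 : ℤ)).tsum_eq]
    refine tsum_congr fun k ↦ ?_
    rw [Equiv.coe_addRight, show 2 * (k + 1) - 1 = 2 * k + 1 by ring]
  have hodds : Summable fun i : ℤ ↦ p ^ (2 * i - 1) ^ 2 * u ^ (2 * i - 1) :=
    summable_thetaPart hp0 hp hu (-1)
  rw [theta_eq_tsum hp0 hp huv, theta_eq_tsum hp0 hp huv', tsum_mul_tsum_of_summable_norm
    (summable_thetaTerm hp0 hp huv).norm (summable_thetaTerm hp0 hp huv').norm,
    ← intProdParityEquiv.tsum_eq]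
  have heven (z : ℤ × ℤ) : p⁻¹ * u * ((p ^ (2 * z.1 - 1) ^ 2 * u ^ (2 * z.1 - 1))
        * (p ^ (2 * z.2 + 0) ^ 2 * v ^ (2 * z.2 + 0)))
      = thetaTerm p (u * v) (z.1 + z.2) * thetaTerm p (u / v) (z.1 - z.2) := by
    obtain ⟨a, b⟩ := z
    dsimp only
    rw [thetaTerm_mul_thetaTerm hp0 hu hv, show a + b + (a - b) = 2 * a by ring,
      show a + b - (a - b) = 2 * b + 0 by ring, (even_two_mul a).neg_one_zpow,
      show 2 * (a + b) ^ 2 - 2 * (a + b) + (2 * (a - b) ^ 2 - 2 * (a - b))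
        = (2 * a - 1) ^ 2 + (2 * b + 0) ^ 2 - 1 by ring,
      zpow_sub_one₀ hp0, zpow_add₀ hp0, zpow_sub_one₀ hu]
    field_simp
  have hodd' (z : ℤ × ℤ) : -(p⁻¹ * u) * ((p ^ (2 * z.1 + 0) ^ 2 * u ^ (2 * z.1 + 0))
        * (p ^ (2 * z.2 + 1) ^ 2 * v ^ (2 * z.2 + 1)))
      = thetaTerm p (u * v) (z.1 + z.2 + 1) * thetaTerm p (u / v) (z.1 - z.2) := by
    obtain ⟨a, b⟩ := z
    dsimp only
    rw [thetaTerm_mul_thetaTerm hp0 hu hv, show a + b + 1 + (a - b) = 2 * a + 0 + 1 by ring,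
      show a + b + 1 - (a - b) = 2 * b + 1 by ring, add_zero,
      (odd_two_mul_add_one a).neg_one_zpow,
      show 2 * (a + b + 1) ^ 2 - 2 * (a + b + 1) + (2 * (a - b) ^ 2 - 2 * (a - b))
        = (2 * a) ^ 2 + (2 * b + 1) ^ 2 - 1 by ring,
      zpow_sub_one₀ hp0, zpow_add₀ hp0, zpow_add_one₀ hu]
    ring
  have h0 := (hasSum_mul_of_summable hodds (summable_thetaPart hp0 hp hv 0)).mul_left (p⁻¹ * u)
  have h1 := (hasSum_mul_of_summable (summable_thetaPart hp0 hp hu 0)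
    (summable_thetaPart hp0 hp hv 1)).mul_left (-(p⁻¹ * u))
  simp only [heven] at h0
  simp only [hodd'] at h1
  refine (HasSum.sum (by simpa only [Function.comp_def, intProdParityEquiv_inl] using h0)
    (by simpa only [Function.comp_def, intProdParityEquiv_inr] using h1)).tsum_eq.trans ?_
  rw [hodd, thetaWronskian, ← thetaPart, ← thetaPart, ← thetaPart]
  ring

/-- The addition theorem for `theta`, at square roots of the parameters. -/
lemma theta_addition_sq {p : ℂ} (hp0 : p ≠ 0) (hp : ‖p‖ < 1) {k₁ k₂ r₁ r₂ t : ℂ} (hk₁ : k₁ ≠ 0)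
    (hk₂ : k₂ ≠ 0) (hr₁ : r₁ ≠ 0) (hr₂ : r₂ ≠ 0) (ht : t ≠ 0) :
    theta (p ^ 4) (r₂ ^ 2 / k₁ ^ 2) * theta (p ^ 4) (k₂ ^ 2 / r₁ ^ 2)
        * (theta (p ^ 4) (k₁ ^ 2 / r₁ ^ 2 * t ^ 2) * theta (p ^ 4) (k₂ ^ 2 / r₂ ^ 2 * t ^ 2))
      + k₂ ^ 2 / r₁ ^ 2 * (theta (p ^ 4) (r₁ ^ 2 / k₁ ^ 2) * theta (p ^ 4) (r₂ ^ 2 / k₂ ^ 2))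
        * (theta (p ^ 4) (k₁ ^ 2 / r₂ ^ 2 * t ^ 2) * theta (p ^ 4) (k₂ ^ 2 / r₁ ^ 2 * t ^ 2))
      = theta (p ^ 4) (r₂ ^ 2 / r₁ ^ 2) * theta (p ^ 4) (k₂ ^ 2 / k₁ ^ 2)
        * (theta (p ^ 4) (k₁ ^ 2 * k₂ ^ 2 / (r₁ ^ 2 * r₂ ^ 2) * t ^ 2)
          * theta (p ^ 4) (t ^ 2)) := by
  obtain ⟨U, hU⟩ : ∃ U, U = k₁ * k₂ * t ^ 2 / (r₁ * r₂) := ⟨_, rfl⟩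
  obtain ⟨A, hA⟩ : ∃ A, A = k₁ * k₂ / (r₁ * r₂) := ⟨_, rfl⟩
  obtain ⟨B, hB⟩ : ∃ B, B = k₁ * r₂ / (r₁ * k₂) := ⟨_, rfl⟩
  obtain ⟨C, hC⟩ : ∃ C, C = k₁ * r₁ / (r₂ * k₂) := ⟨_, rfl⟩
  have hU0 : U ≠ 0 := by rw [hU]; positivity
  have hA0 : A ≠ 0 := by rw [hA]; positivity
  have hB0 : B ≠ 0 := by rw [hB]; positivity
  have hC0 : C ≠ 0 := by rw [hC]; positivity
  have hsplit {x y u v : ℂ} (hu : u ≠ 0) (hv : v ≠ 0) (hx : x = u * v) (hy : y = u / v) :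
      theta (p ^ 4) x * theta (p ^ 4) y = p⁻¹ * u * thetaWronskian p u v := by
    rw [hx, hy, theta_mul_theta hp0 hp hu hv]
  rw [hsplit (inv_ne_zero hC0) (inv_ne_zero hA0)
      (y := k₂ ^ 2 / r₁ ^ 2) (by rw [hA, hC]; field_simp) (by rw [hA, hC]; field_simp),
    hsplit hU0 hB0 (y := k₂ ^ 2 / r₂ ^ 2 * t ^ 2) (by rw [hU, hB]; field_simp)
      (by rw [hU, hB]; field_simp),
    hsplit (inv_ne_zero hA0) (inv_ne_zero hB0) (y := r₂ ^ 2 / k₂ ^ 2)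
      (by rw [hA, hB]; field_simp) (by rw [hA, hB]; field_simp),
    hsplit hU0 hC0 (y := k₂ ^ 2 / r₁ ^ 2 * t ^ 2) (by rw [hU, hC]; field_simp)
      (by rw [hU, hC]; field_simp),
    hsplit (inv_ne_zero hC0) hB0 (y := k₂ ^ 2 / k₁ ^ 2) (by rw [hC, hB]; field_simp)
      (by rw [hC, hB]; field_simp),
    hsplit hU0 hA0 (y := t ^ 2) (by rw [hU, hA]; field_simp) (by rw [hU, hA]; field_simp)]
  simp only [thetaWronskian_inv_left, thetaWronskian_inv_right]
  have hcoef : k₂ ^ 2 / r₁ ^ 2 * A⁻¹ = C⁻¹ := by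
    rw [hA, hC]
    field_simp
  linear_combination p⁻¹ * p⁻¹ * U * C⁻¹ * thetaWronskian_plucker p U C A B
    + p⁻¹ * p⁻¹ * U * thetaWronskian p A B * thetaWronskian p U C * hcoef

theorem theta_addition {q : ℂ} (hq0 : q ≠ 0) (hq : ‖q‖ < 1) {κ₁ κ₂ ρ₁ ρ₂ y : ℂ} (hκ₁ : κ₁ ≠ 0)
    (hκ₂ : κ₂ ≠ 0) (hρ₁ : ρ₁ ≠ 0) (hρ₂ : ρ₂ ≠ 0) (hy : y ≠ 0) :
    theta q (ρ₂ / κ₁) * theta q (κ₂ / ρ₁) * (theta q (κ₁ / ρ₁ * y) * theta q (κ₂ / ρ₂ * y))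
      + κ₂ / ρ₁ * (theta q (ρ₁ / κ₁) * theta q (ρ₂ / κ₂))
        * (theta q (κ₁ / ρ₂ * y) * theta q (κ₂ / ρ₁ * y))
      = theta q (ρ₂ / ρ₁) * theta q (κ₂ / κ₁)
        * (theta q (κ₁ * κ₂ / (ρ₁ * ρ₂) * y) * theta q y) := by
  obtain ⟨p, hp0, hp, rfl⟩ := exists_fourth_root hq0 hq
  obtain ⟨k₁, rfl⟩ := IsAlgClosed.exists_pow_nat_eq κ₁ two_pos
  obtain ⟨k₂, rfl⟩ := IsAlgClosed.exists_pow_nat_eq κ₂ two_pos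
  obtain ⟨r₁, rfl⟩ := IsAlgClosed.exists_pow_nat_eq ρ₁ two_pos
  obtain ⟨r₂, rfl⟩ := IsAlgClosed.exists_pow_nat_eq ρ₂ two_pos
  obtain ⟨t, rfl⟩ := IsAlgClosed.exists_pow_nat_eq y two_pos
  rw [pow_ne_zero_iff two_ne_zero] at *
  exact theta_addition_sq hp0 hp hκ₁ hκ₂ hρ₁ hρ₂ hy

/-- the determinant relation (det-rel) for the connection matrix of a
`q`-hypergeometric oper holds for all `x ∈ ℂ^×` iff the two scalar relations
(Mrel1) and (Mrel2) hold. -/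
theorem detRel_iff_Mrel (q : ℂ) (hq0 : q ≠ 0) (hq1 : ‖q‖ < 1)
    (ξ ρ1 ρ2 κ1 κ2 : ℂ) (hξ : ξ ≠ 0) (hρ1 : ρ1 ≠ 0) (hρ2 : ρ2 ≠ 0)
    (hκ1 : κ1 ≠ 0) (hκ2 : κ2 ≠ 0)
    (hρ : ∀ m : ℤ, ρ2 / ρ1 ≠ q ^ m) (hκ : ∀ m : ℤ, κ2 / κ1 ≠ q ^ m)
    (m11 m12 m21 m22 K : ℂ) :
    (∀ x : ℂ, x ≠ 0 →
        m11 * m22 * theta q (κ1 / ρ1 * (x / ξ)) * theta q (κ2 / ρ2 * (x / ξ))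
          - m12 * m21 * theta q (κ1 / ρ2 * (x / ξ)) * theta q (κ2 / ρ1 * (x / ξ))
        = K * theta q (κ1 * κ2 / (ρ1 * ρ2) * x / ξ) * theta q (x / ξ)) ↔
      (m11 * m22
          = K * theta q (ρ2 / κ1) * theta q (κ2 / ρ1) /
              (theta q (ρ2 / ρ1) * theta q (κ2 / κ1)) ∧
        m12 * m21
          = -K * (κ2 / ρ1) * theta q (ρ1 / κ1) * theta q (ρ2 / κ2) /
              (theta q (ρ2 / ρ1) * theta q (κ2 / κ1))) := by
  have hθ : theta q (ρ2 / ρ1) * theta q (κ2 / κ1) ≠ 0 :=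
    mul_ne_zero (theta_ne_zero hq1 (div_ne_zero hρ2 hρ1) hρ)
      (theta_ne_zero hq1 (div_ne_zero hκ2 hκ1) hκ)
  constructor
  · intro h
    have hinv {a b : ℂ} (ha : a ≠ 0) (hb : b ≠ 0) :
        theta q (a / b) = -(a / b) * theta q (b / a) := by
      rw [← inv_div b a, theta_inv hq0 hq1 (div_ne_zero hb ha)]
    constructor
    · have h1 := h (ρ2 / κ1 * ξ) (by positivity)
      rw [show κ1 / ρ1 * (ρ2 / κ1 * ξ / ξ) = ρ2 / ρ1 by field_simp,
        show κ2 / ρ2 * (ρ2 / κ1 * ξ / ξ) = κ2 / κ1 by field_simp,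
        show κ1 / ρ2 * (ρ2 / κ1 * ξ / ξ) = 1 by field_simp,
        show κ1 * κ2 / (ρ1 * ρ2) * (ρ2 / κ1 * ξ) / ξ = κ2 / ρ1 by field_simp,
        show ρ2 / κ1 * ξ / ξ = ρ2 / κ1 by field_simp, theta_one] at h1
      rw [eq_div_iff hθ]
      linear_combination h1
    · have h2 := h (ρ1 / κ1 * ξ) (by positivity)
      rw [show κ1 / ρ1 * (ρ1 / κ1 * ξ / ξ) = 1 by field_simp,
        show κ1 / ρ2 * (ρ1 / κ1 * ξ / ξ) = ρ1 / ρ2 by field_simp,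
        show κ2 / ρ1 * (ρ1 / κ1 * ξ / ξ) = κ2 / κ1 by field_simp,
        show κ1 * κ2 / (ρ1 * ρ2) * (ρ1 / κ1 * ξ) / ξ = κ2 / ρ2 by field_simp,
        show ρ1 / κ1 * ξ / ξ = ρ1 / κ1 by field_simp, theta_one, hinv hρ1 hρ2, hinv hκ2 hρ2] at h2
      rw [eq_div_iff hθ]
      field_simp at h2 ⊢
      linear_combination h2
  · rintro ⟨h1, h2⟩ x hx
    have hadd := theta_addition hq0 hq1 hκ1 hκ2 hρ1 hρ2 (div_ne_zero hx hξ)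
    rw [h1, h2, mul_div_assoc _ x ξ]
    generalize theta q (ρ2 / ρ1) * theta q (κ2 / κ1) = D at hadd hθ ⊢
    field_simp at hadd ⊢
    linear_combination K * hadd

end
end

section
/- With the notation and hypotheses below, fix an index 1 ≤ i ≤ l_0 and for λ ∈ ℂ let D_i(λ) be the determinant of the 3×3 matrix [[b(𝗊 s_i), c(𝗊 s_i)(1 − λP'_i), 0], [a(s_i), b(s_i), c(s_i)(1 − λP_i)], [0, a(𝗊^{−1}s_i), b(𝗊^{−1}s_i)]]. Then the following are equivalent: (i) D_i(λ) = 0 for all λ ∈ ℂ; (ii) D_i(0) = 0 and the zeroth Bethe equation holds at s_i, namely p_0 ∏_{k=1}^{l_0} (𝗊 s_i − s_k)/(s_i − 𝗊 s_k) · ∏_{j=1}^{l_1} (𝗊^{−1}s_i − t_j)/(s_i − 𝗊^{−1}t_j) = −Ψ_0(s_i). -/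
open Polynomial

noncomputable section

/-- `y(x) = ∏ (x − z_i)` as a polynomial. -/
def prodPoly {m : ℕ} (z : Fin m → ℂ) : Polynomial ℂ := ∏ i, (X - C (z i))

/-- `a(x) = ā(x) y_0(𝗊⁻¹ x)`. -/
def aF (q : ℂ) (abar y0 : Polynomial ℂ) (x : ℂ) : ℂ :=
  abar.eval x * y0.eval (q⁻¹ * x)

/-- `c(x) = c̄(x) y_0(𝗊 x)`. -/
def cF (q : ℂ) (cbar y0 : Polynomial ℂ) (x : ℂ) : ℂ :=
  cbar.eval x * y0.eval (q * x)

/-- `b(x) = a(x) y_1(𝗊 x)/y_1(x) + c(x) y_1(𝗊⁻¹ x)/y_1(x)`. -/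
def bF (q : ℂ) (abar cbar y0 y1 : Polynomial ℂ) (x : ℂ) : ℂ :=
  aF q abar y0 x * y1.eval (q * x) / y1.eval x
    + cF q cbar y0 x * y1.eval (q⁻¹ * x) / y1.eval x

/-- The `3 × 3` determinant `D_i(λ)` at the point `z = s_i`. -/
def Dlam (q : ℂ) (abar cbar y0 y1 : Polynomial ℂ) (P P' z lam : ℂ) : ℂ :=
  Matrix.det
    !![bF q abar cbar y0 y1 (q * z), cF q cbar y0 (q * z) * (1 - lam * P'), 0;
       aF q abar y0 z, bF q abar cbar y0 y1 z, cF q cbar y0 z * (1 - lam * P);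
       0, aF q abar y0 (q⁻¹ * z), bF q abar cbar y0 y1 (q⁻¹ * z)]

theorem eval_prodPoly {m : ℕ} (z : Fin m → ℂ) (x : ℂ) :
    (prodPoly z).eval x = ∏ i, (x - z i) := by
  simp [prodPoly, eval_prod]

/-- The node `z i` is a zero of `prodPoly z`. -/
theorem eval_prodPoly_self {m : ℕ} (z : Fin m → ℂ) (i : Fin m) :
    (prodPoly z).eval (z i) = 0 := by
  rw [eval_prodPoly]
  exact Finset.prod_eq_zero (Finset.mem_univ i) (sub_self _)

/-- Scaling the nodes of `prodPoly z` by `q` amounts to scaling the variable by `q⁻¹`. -/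
theorem prod_sub_mul_eq {m : ℕ} (z : Fin m → ℂ) {q : ℂ} (hq : q ≠ 0) (x : ℂ) :
    ∏ i, (x - q * z i) = q ^ m * (prodPoly z).eval (q⁻¹ * x) := by
  have h : ∀ i, x - q * z i = q * (q⁻¹ * x - z i) := fun i => by field_simp
  simp [eval_prodPoly, h, Finset.prod_mul_distrib]

/-- The left-hand side of a Bethe equation in terms of values of the two polynomials. -/
theorem bethe_prod_eq {m n : ℕ} (s : Fin m → ℂ) (t : Fin n → ℂ) {q : ℂ} (hq : q ≠ 0)
    (x : ℂ) :
    (∏ k, (q * x - s k) / (x - q * s k)) * (∏ j, (q⁻¹ * x - t j) / (x - q⁻¹ * t j))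
      = (prodPoly s).eval (q * x) / (q ^ m * (prodPoly s).eval (q⁻¹ * x))
        * ((prodPoly t).eval (q⁻¹ * x) / ((q ^ n)⁻¹ * (prodPoly t).eval (q * x))) := by
  rw [Finset.prod_div_distrib, Finset.prod_div_distrib, prod_sub_mul_eq s hq,
    prod_sub_mul_eq t (inv_ne_zero hq), inv_inv, inv_pow, ← eval_prodPoly, ← eval_prodPoly]

/-- The determinant `Dlam` is affine in `lam`. -/
theorem Dlam_eq_add_mul (q : ℂ) (abar cbar y0 y1 : Polynomial ℂ) (P P' z lam : ℂ) :
    Dlam q abar cbar y0 y1 P P' z lam = Dlam q abar cbar y0 y1 P P' z 0 +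
      lam * (bF q abar cbar y0 y1 (q * z) * cF q cbar y0 z * aF q abar y0 (q⁻¹ * z) * P
        + cF q cbar y0 (q * z) * aF q abar y0 z * bF q abar cbar y0 y1 (q⁻¹ * z) * P') := by
  simp only [Dlam, Matrix.det_fin_three, Matrix.of_apply, Matrix.cons_val', Matrix.cons_val]
  ring

theorem Dlam_eq_zero_forall_iff (q : ℂ) (abar cbar y0 y1 : Polynomial ℂ) (P P' z : ℂ) :
    (∀ lam, Dlam q abar cbar y0 y1 P P' z lam = 0) ↔
      Dlam q abar cbar y0 y1 P P' z 0 = 0 ∧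
      bF q abar cbar y0 y1 (q * z) * cF q cbar y0 z * aF q abar y0 (q⁻¹ * z) * P
        + cF q cbar y0 (q * z) * aF q abar y0 z * bF q abar cbar y0 y1 (q⁻¹ * z) * P' = 0 := by
  constructor
  · intro h
    refine ⟨h 0, ?_⟩
    have h1 := h 1
    rwa [Dlam_eq_add_mul, h 0, zero_add, one_mul] at h1
  · rintro ⟨h0, h1⟩ lam
    rw [Dlam_eq_add_mul, h0, h1, mul_zero, add_zero]

/-- At `q z` with `y0 z = 0`, only the second summand of `bF` survives. -/
theorem bF_mul_of_eval_eq_zero {q : ℂ} (hq : q ≠ 0) (abar cbar y0 y1 : Polynomial ℂ) {z : ℂ}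
    (hz : y0.eval z = 0) :
    bF q abar cbar y0 y1 (q * z) = cF q cbar y0 (q * z) * y1.eval z / y1.eval (q * z) := by
  simp [bF, aF, inv_mul_cancel_left₀ hq, hz]

/-- At `q⁻¹ z` with `y0 z = 0`, only the first summand of `bF` survives. -/
theorem bF_inv_mul_of_eval_eq_zero {q : ℂ} (hq : q ≠ 0) (abar cbar y0 y1 : Polynomial ℂ)
    {z : ℂ} (hz : y0.eval z = 0) :
    bF q abar cbar y0 y1 (q⁻¹ * z)
      = aF q abar y0 (q⁻¹ * z) * y1.eval z / y1.eval (q⁻¹ * z) := by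
  simp [bF, cF, mul_inv_cancel_left₀ hq, hz]

/-- the `λ`-oper `L_λ` has an apparent singularity at `𝗊 s_i` for all `λ`
iff `L_0` has an apparent singularity at `𝗊 s_i` and the zeroth Bethe equation holds
at `s_i`. -/
theorem lambda_oper_apparent_iff (q : ℂ) (hq0 : q ≠ 0) (hq1 : ‖q‖ < 1)
    (p0 p1 : ℂ) (hp0 : p0 ≠ 0) (hp1 : p1 ≠ 0)
    (abar cbar : Polynomial ℂ) (hcop : IsCoprime abar cbar)
    (l0 l1 : ℕ) (s : Fin l0 → ℂ) (t : Fin l1 → ℂ)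
    (hs : ∀ i, s i ≠ 0) (ht : ∀ j, t j ≠ 0)
    (Ψ0 : RatFunc ℂ)
    -- well-definedness of the denominators in the Bethe equations
    (hwd1 : ∀ j l : Fin l1, j ≠ l → t j ≠ q * t l)
    (hwd2 : ∀ (j : Fin l1) (i : Fin l0), t j ≠ q⁻¹ * s i)
    (hwd3 : ∀ i k : Fin l0, i ≠ k → s i ≠ q * s k)
    (hwd4 : ∀ (i : Fin l0) (j : Fin l1), s i ≠ q⁻¹ * t j)
    (hwd5 : ∀ j : Fin l1, abar.eval (t j) ≠ 0)
    -- the first Bethe equations, with Ψ_1(x) = p_1 𝗊^{l_0−l_1} c̄(x)/ā(x)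
    (hBethe1 : ∀ j : Fin l1,
      p1 * (∏ l, (q * t j - t l) / (t j - q * t l))
        * (∏ i, (q⁻¹ * t j - s i) / (t j - q⁻¹ * s i))
      = -(p1 * q ^ ((l0 : ℤ) - (l1 : ℤ)) * cbar.eval (t j) / abar.eval (t j)))
    -- the fixed index i and the nondegeneracy conditions at s_i
    (i : Fin l0)
    (hΨ0fin : Ψ0.denom.eval (s i) ≠ 0)
    (hΨ0ne : RatFunc.eval (RingHom.id ℂ) (s i) Ψ0 ≠ 0)
    (hnd1 : abar.eval (s i) ≠ 0) (hnd2 : abar.eval (q⁻¹ * s i) ≠ 0)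
    (hnd3 : cbar.eval (s i) ≠ 0) (hnd4 : cbar.eval (q * s i) ≠ 0)
    (hnd5 : (prodPoly s).eval (q * s i) ≠ 0) (hnd6 : (prodPoly s).eval (q⁻¹ * s i) ≠ 0)
    (hnd7 : (prodPoly t).eval (s i) ≠ 0)
    (hnd8 : (prodPoly t).eval (q * s i) ≠ 0) (hnd9 : (prodPoly t).eval (q⁻¹ * s i) ≠ 0)
    (hnd10 : aF q abar (prodPoly s) (s i) ≠ 0)
    (hnd11 : aF q abar (prodPoly s) (q⁻¹ * s i) ≠ 0)
    (hnd12 : cF q cbar (prodPoly s) (s i) ≠ 0)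
    (hnd13 : cF q cbar (prodPoly s) (q * s i) ≠ 0)
    (hnd14 : bF q abar cbar (prodPoly s) (prodPoly t) (q * s i) ≠ 0)
    (hnd15 : bF q abar cbar (prodPoly s) (prodPoly t) (q⁻¹ * s i) ≠ 0)
    -- the values P = P(s_i), P' = P(𝗊 s_i) with p_0 p_1 P'/P = Ψ_0(s_i) Ψ_1(s_i)
    (P P' : ℂ) (hP : P ≠ 0) (hP' : P' ≠ 0)
    (hPP' : p0 * p1 * P' / P
      = RatFunc.eval (RingHom.id ℂ) (s i) Ψ0 *
          (p1 * q ^ ((l0 : ℤ) - (l1 : ℤ)) * cbar.eval (s i) / abar.eval (s i))) :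
    (∀ lam : ℂ, Dlam q abar cbar (prodPoly s) (prodPoly t) P P' (s i) lam = 0) ↔
      (Dlam q abar cbar (prodPoly s) (prodPoly t) P P' (s i) 0 = 0 ∧
        p0 * (∏ k, (q * s i - s k) / (s i - q * s k))
            * (∏ j, (q⁻¹ * s i - t j) / (s i - q⁻¹ * t j))
          = -(RatFunc.eval (RingHom.id ℂ) (s i) Ψ0)) := by
  have hz := eval_prodPoly_self s i
  rw [Dlam_eq_zero_forall_iff, bF_mul_of_eval_eq_zero hq0 _ _ _ _ hz,
    bF_inv_mul_of_eval_eq_zero hq0 _ _ _ _ hz, mul_assoc p0, bethe_prod_eq s t hq0]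
  refine and_congr_right fun _ => ?_
  set z := s i
  generalize cF q cbar (prodPoly s) (q * z) = cp at *
  generalize aF q abar (prodPoly s) (q⁻¹ * z) = am at *
  simp only [aF, cF] at *
  generalize RatFunc.eval (RingHom.id ℂ) z Ψ0 = ψ at *
  generalize eval (q * z) (prodPoly s) = Y at *
  generalize eval (q⁻¹ * z) (prodPoly s) = y at *
  generalize eval (q * z) (prodPoly t) = W at *
  generalize eval (q⁻¹ * z) (prodPoly t) = w at *
  generalize eval z (prodPoly t) = u at *
  generalize eval z abar = α at *
  generalize eval z cbar = γ at *
  rw [zpow_sub₀ hq0, zpow_natCast, zpow_natCast] at hPP'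
  have hQ0 : q ^ l0 ≠ 0 := pow_ne_zero _ hq0
  have hQ1 : q ^ l1 ≠ 0 := pow_ne_zero _ hq0
  generalize q ^ l0 = Q0 at *
  generalize q ^ l1 = Q1 at *
  have hP'eq : P' = ψ * (Q0 / Q1 * γ / α) * P / p0 := by
    field_simp at hPP' ⊢
    linear_combination hPP'
  have key : cp * u / W * (γ * Y) * am * P + cp * (α * y) * (am * u / w) * P'
      = cp * u * am * γ * P * y * Q0 / (w * Q1 * p0)
        * (p0 * (Y / (Q0 * y) * (w / (Q1⁻¹ * W))) + ψ) := by
    rw [hP'eq]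
    field_simp
  have hne : cp * u * am * γ * P * y * Q0 / (w * Q1 * p0) ≠ 0 := by
    simp [*]
  rw [key, mul_eq_zero_iff_left hne, eq_neg_iff_add_eq_zero]

end
end

section
/- Let q_2 ∈ ℂ^×, q_1, q_3 ∈ ℂ^× with q_1 q_3 = q_2^{−1}, p_1, κ, x_1 ∈ ℂ^×, l_0, l_1 ∈ ℤ_{≥0}, and nonzero s_1, …, s_{l_0} ∈ ℂ. Define polynomials by a_0(q_2^{−1}x) = p_1 q_2^{−l_0−l_1}(x − κ x_1) ∏_{j=1}^{l_0}(x − q_1^{−1}s_j)(x − q_3^{−1}s_j) and a_2(q_2^{−1}x) = q_2^{−l_0}(κ x − x_1) ∏_{j=1}^{l_0}(x − q_1 s_j)(x − q_3 s_j), and let a_1(x) be a polynomial with deg a_1 ≤ 2l_0 + 1. Suppose there is a monic polynomial y_1(x) of degree l_1 with y_1(0) ≠ 0 such that a_0(x) y_1(q_2² x) − a_1(x) y_1(q_2 x) + a_2(x) y_1(x) = 0. Then, writing a_1(q_2^{−1}x) = ∑_{j=0}^{2l_0+1} a_{1,j} x^{2l_0+1−j}, one has a_{1,0} = p_1 q_2^{−l_0}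 + q_2^{−l_0−l_1} κ and a_{1,2l_0+1} = −(p_1 q_2^{−l_1} κ + q_2^{−2l_0}) x_1 ∏_{j=1}^{l_0} s_j². -/
open Polynomial

noncomputable section

theorem natDegree_comp_C_mul_X_le {R : Type*} [CommSemiring R] (p : Polynomial R) (r : R) :
    (p.comp (C r * X)).natDegree ≤ p.natDegree :=
  natDegree_le_iff_coeff_eq_zero.mpr fun n hn => by
    rw [comp_C_mul_X_coeff, coeff_eq_zero_of_natDegree_lt hn, zero_mul]

theorem natDegree_prod_X_sub_C_mul_X_sub_C_le {R : Type*} [CommRing R] {n : ℕ}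
    (u v : Fin n → R) :
    (∏ j, ((X - C (u j)) * (X - C (v j)))).natDegree ≤ 2 * n := by
  refine (natDegree_prod_le _ _).trans ?_
  refine (Finset.sum_le_card_nsmul _ _ 2 fun j _ => ?_).trans (by simp [mul_comm])
  exact natDegree_mul_le_of_le (natDegree_X_sub_C_le _) (natDegree_X_sub_C_le _)

theorem coeff_prod_X_sub_C_mul_X_sub_C {R : Type*} [CommRing R] [Nontrivial R] {n : ℕ}
    (u v : Fin n → R) :
    (∏ j, ((X - C (u j)) * (X - C (v j)))).coeff (2 * n) = 1 := by
  have hm : (∏ j, ((X - C (u j)) * (X - C (v j)))).Monic :=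
    monic_prod_of_monic _ _ fun j _ => (monic_X_sub_C _).mul (monic_X_sub_C _)
  have hd : (∏ j, ((X - C (u j)) * (X - C (v j)))).natDegree = 2 * n := by
    rw [natDegree_prod_of_monic _ _ fun j _ => (monic_X_sub_C _).mul (monic_X_sub_C _)]
    simp [(monic_X_sub_C _).natDegree_mul (monic_X_sub_C _), mul_comm]
  rw [← hd]
  exact hm.coeff_natDegree

/-- The degree bound and the two extreme coefficients of a linear factor times a product of
pairs of monic linear factors. -/
theorem natDegree_le_and_coeff_C_mul_linear_mul_prod {R : Type*} [CommRing R] [Nontrivial R]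
    {n : ℕ} (c a b : R) (u v : Fin n → R) :
    let f := C c * ((C a * X - C b) * ∏ j, ((X - C (u j)) * (X - C (v j))))
    f.natDegree ≤ 2 * n + 1 ∧ f.coeff (2 * n + 1) = c * a ∧
      f.coeff 0 = -(c * b * ∏ j, u j * v j) := by
  have hl : (C a * X - C b : Polynomial R).natDegree ≤ 1 := by compute_degree
  have hp := natDegree_prod_X_sub_C_mul_X_sub_C_le u v
  refine ⟨?_, ?_, ?_⟩
  · exact (natDegree_C_mul_le _ _).trans
      ((natDegree_mul_le_of_le hl hp).trans_eq (add_comm _ _))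
  · rw [coeff_C_mul, add_comm, coeff_mul_add_eq_of_natDegree_le hl hp,
      coeff_prod_X_sub_C_mul_X_sub_C]
    simp
  · simp [coeff_zero_eq_eval_zero, eval_prod, mul_assoc]

/-- equation (a1): the polynomial solution `y_1` of `L y = 0` determines
the leading and constant coefficients of `a_1(q_2^{-1} x)`. -/
theorem a1_top_and_constant_coeff
    (q1 q2 q3 p1 κ x1 : ℂ)
    (hq1 : q1 ≠ 0) (hq2 : q2 ≠ 0) (hq3 : q3 ≠ 0)
    (hp1 : p1 ≠ 0) (hκ : κ ≠ 0) (hx1 : x1 ≠ 0)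
    (hq13 : q1 * q3 = q2⁻¹)
    (l0 l1 : ℕ) (s : Fin l0 → ℂ) (hs : ∀ j, s j ≠ 0)
    (a0 a1 a2 : Polynomial ℂ)
    (ha0 : a0.comp (C q2⁻¹ * X)
      = C (p1 * q2 ^ (-(l0 : ℤ) - (l1 : ℤ))) * ((X - C (κ * x1)) *
          ∏ j, ((X - C (q1⁻¹ * s j)) * (X - C (q3⁻¹ * s j)))))
    (ha2 : a2.comp (C q2⁻¹ * X)
      = C (q2 ^ (-(l0 : ℤ))) * ((C κ * X - C x1) *
          ∏ j, ((X - C (q1 * s j)) * (X - C (q3 * s j)))))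
    (hdeg : a1.natDegree ≤ 2 * l0 + 1)
    (y1 : Polynomial ℂ) (hy1monic : y1.Monic) (hy1deg : y1.natDegree = l1)
    (hy10 : y1.eval 0 ≠ 0)
    (heq : a0 * (y1.comp (C (q2 ^ 2) * X)) - a1 * (y1.comp (C q2 * X)) + a2 * y1 = 0) :
    (a1.comp (C q2⁻¹ * X)).coeff (2 * l0 + 1)
        = p1 * q2 ^ (-(l0 : ℤ)) + q2 ^ (-(l0 : ℤ) - (l1 : ℤ)) * κ ∧
      (a1.comp (C q2⁻¹ * X)).coeff 0
        = -(p1 * q2 ^ (-(l1 : ℤ)) * κ + q2 ^ (-2 * (l0 : ℤ))) * (x1 * ∏ j, (s j) ^ 2) := by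
  set A0 := a0.comp (C q2⁻¹ * X)
  set A1 := a1.comp (C q2⁻¹ * X)
  set A2 := a2.comp (C q2⁻¹ * X)
  have key : A0 * y1.comp (C q2 * X) + A2 * y1.comp (C q2⁻¹ * X) = A1 * y1 := by
    have h := congrArg (fun p => p.comp (C q2⁻¹ * X)) heq
    simp only [add_comp, sub_comp, mul_comp, zero_comp, comp_assoc, C_comp, X_comp] at h
    rw [← mul_assoc, ← mul_assoc, ← C_mul, ← C_mul, mul_inv_cancel₀ hq2, C_1, one_mul, comp_X,
      pow_two, mul_assoc q2, mul_inv_cancel₀ hq2, mul_one] at h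
    linear_combination h
  have hd1 : A1.natDegree ≤ 2 * l0 + 1 := (natDegree_comp_C_mul_X_le _ _).trans hdeg
  clear_value A0 A1 A2
  have hy (r : ℂ) : (y1.comp (C r * X)).natDegree ≤ l1 :=
    (natDegree_comp_C_mul_X_le _ _).trans hy1deg.le
  have hytop : y1.coeff l1 = 1 := hy1deg ▸ hy1monic.coeff_natDegree
  obtain ⟨hd0, ht0, hc0⟩ := natDegree_le_and_coeff_C_mul_linear_mul_prod
    (p1 * q2 ^ (-(l0 : ℤ) - (l1 : ℤ))) 1 (κ * x1) (fun j => q1⁻¹ * s j) (fun j => q3⁻¹ * s j)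
  obtain ⟨hd2, ht2, hc2⟩ := natDegree_le_and_coeff_C_mul_linear_mul_prod
    (q2 ^ (-(l0 : ℤ))) κ x1 (fun j => q1 * s j) (fun j => q3 * s j)
  rw [C_1, one_mul, ← ha0] at hd0 ht0 hc0
  rw [← ha2] at hd2 ht2 hc2
  constructor
  · have h := congrArg (fun p => p.coeff (2 * l0 + 1 + l1)) key
    simp only [coeff_add] at h
    rw [coeff_mul_add_eq_of_natDegree_le hd0 (hy _), coeff_mul_add_eq_of_natDegree_le hd2 (hy _),
      coeff_mul_add_eq_of_natDegree_le hd1 hy1deg.le, comp_C_mul_X_coeff, comp_C_mul_X_coeff,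
      hytop, ht0, ht2] at h
    rw [← mul_one (A1.coeff _), ← h, zpow_sub₀ hq2, zpow_natCast, inv_pow]
    field_simp
  · have h := congrArg (fun p => p.coeff 0) key
    simp only [coeff_add, mul_coeff_zero, comp_C_mul_X_coeff, pow_zero, mul_one] at h
    rw [← add_mul] at h
    have hprod0 : ∏ j, (q1⁻¹ * s j) * (q3⁻¹ * s j) = q2 ^ l0 * ∏ j, s j ^ 2 := by
      have hinv : q1⁻¹ * q3⁻¹ = q2 := by rw [← mul_inv, hq13, inv_inv]
      rw [Finset.prod_congr rfl fun j _ => show (q1⁻¹ * s j) * (q3⁻¹ * s j) = q2 * s j ^ 2 by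
        rw [mul_mul_mul_comm, hinv, pow_two]]
      simp [Finset.prod_mul_distrib]
    have hprod2 : ∏ j, (q1 * s j) * (q3 * s j) = (q2 ^ l0)⁻¹ * ∏ j, s j ^ 2 := by
      rw [Finset.prod_congr rfl fun j _ => show (q1 * s j) * (q3 * s j) = q2⁻¹ * s j ^ 2 by
        rw [mul_mul_mul_comm, hq13, pow_two]]
      simp [Finset.prod_mul_distrib]
    rw [← mul_right_cancel₀ (by rwa [coeff_zero_eq_eval_zero]) h, hc0, hc2, hprod0, hprod2,
      zpow_sub₀ hq2, show (-2 * (l0 : ℤ)) = -(l0 : ℤ) + -(l0 : ℤ) by ring, zpow_add₀ hq2,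
      zpow_neg, zpow_neg, zpow_natCast, zpow_natCast]
    field_simp
    ring

end
end
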